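/- Let X be a real n × K matrix with linearly independent columns, D an n × n diagonal matrix with diagonal entries in (0,1] summing to 1, P an n × n row-stochastic matrix, r ∈ ℝⁿ, γ ∈ [0, 1), η > 0, ξ ∈ (0, 1), and assume γ ‖X‖ ‖P‖_D ≤ 2(1 − ξ)√η where ‖P‖_D := ‖D^{1/2} P D^{−1/2}‖. Let q := (I − γP)⁻¹ r (the unique solution of q = r + γPq), let Π^η_D := X(XᵀDX + ηI)⁻¹XᵀD, and let w*_η be the unique solution of (Xᵀ D (I − γP) X + ηI) w = Xᵀ D r. Then ‖X w*_η − q‖ ≤ (1/ξ) ‖Π^η_D q − q‖. -/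

import Mathlib

open Matrix

/-- The operator norm of a real matrix induced by the Euclidean norms
(i.e., its largest singular value). -/
noncomputable def opNorm {m n : Type*} [Fintype m] [Fintype n] [DecidableEq n]
    (M : Matrix m n ℝ) : ℝ :=
  ‖LinearMap.toContinuousLinearMap (Matrix.toEuclideanLin M)‖

/-- The Euclidean norm of a plain vector. -/
noncomputable def evnorm {n : Type*} [Fintype n] (v : n → ℝ) : ℝ :=
  ‖(WithLp.equiv 2 (n → ℝ)).symm v‖



lemma evnorm_eq {n : Type*} [Fintype n] (v : n → ℝ) : evnorm v = ‖WithLp.toLp 2 v‖ := rfl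

lemma evnorm_nonneg {n : Type*} [Fintype n] (v : n → ℝ) : 0 ≤ evnorm v := norm_nonneg _

lemma evnorm_sq {n : Type*} [Fintype n] (v : n → ℝ) : evnorm v ^ 2 = ∑ i, v i ^ 2 := by
  rw [evnorm_eq, EuclideanSpace.real_norm_sq_eq]

lemma evnorm_add {n : Type*} [Fintype n] (v w : n → ℝ) :
    evnorm (v + w) ≤ evnorm v + evnorm w := by
  simp only [evnorm_eq, WithLp.toLp_add]
  exact norm_add_le _ _

lemma evnorm_smul {n : Type*} [Fintype n] (c : ℝ) (v : n → ℝ) :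
    evnorm (c • v) = |c| * evnorm v := by
  simp only [evnorm_eq, WithLp.toLp_smul, norm_smul, Real.norm_eq_abs]

lemma evnorm_cs {n : Type*} [Fintype n] (v w : n → ℝ) :
    v ⬝ᵥ w ≤ evnorm v * evnorm w := by
  apply le_of_abs_le
  apply abs_le_of_sq_le_sq _ (mul_nonneg (evnorm_nonneg _) (evnorm_nonneg _))
  rw [mul_pow, evnorm_sq, evnorm_sq]
  exact Finset.sum_mul_sq_le_sq_mul_sq _ _ _

lemma opNorm_nonneg {m n : Type*} [Fintype m] [Fintype n] [DecidableEq n]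
    (M : Matrix m n ℝ) : 0 ≤ opNorm M := norm_nonneg _

lemma evnorm_mulVec {m n : Type*} [Fintype m] [Fintype n] [DecidableEq n]
    (M : Matrix m n ℝ) (v : n → ℝ) : evnorm (M *ᵥ v) ≤ opNorm M * evnorm v :=
  (LinearMap.toContinuousLinearMap (Matrix.toEuclideanLin M)).le_opNorm (WithLp.toLp 2 v)

lemma dot_self_ev {n : Type*} [Fintype n] (v : n → ℝ) : v ⬝ᵥ v = evnorm v ^ 2 := by
  rw [evnorm_sq]; simp [dotProduct, sq]

lemma ridge_bound {m k : Type*} [Fintype m] [Fintype k] [DecidableEq k]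
    (A : Matrix m k ℝ) {η : ℝ} (hη : 0 < η) (z : k → ℝ) (s : m → ℝ)
    (h : (Aᵀ * A + η • (1 : Matrix k k ℝ)) *ᵥ z = Aᵀ *ᵥ s) :
    2 * Real.sqrt η * evnorm z ≤ evnorm s := by
  have h1 : evnorm (A *ᵥ z) ^ 2 + η * evnorm z ^ 2 = (A *ᵥ z) ⬝ᵥ s := by
    have h2 := congrArg (fun t => z ⬝ᵥ t) h
    simp only [add_mulVec, smul_mulVec, one_mulVec, dotProduct_add, dotProduct_smul,
      ← mulVec_mulVec, smul_eq_mul] at h2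
    rw [dotProduct_mulVec z Aᵀ, dotProduct_mulVec z Aᵀ, vecMul_transpose, dot_self_ev,
      dot_self_ev] at h2
    exact h2
  have h2 := evnorm_cs (A *ᵥ z) s
  refine le_of_abs_le (abs_le_of_sq_le_sq ?_ (evnorm_nonneg _))
  rw [mul_pow, mul_pow, Real.sq_sqrt hη.le]
  nlinarith [sq_nonneg (2 * evnorm (A *ᵥ z) - evnorm s)]

lemma one_sub_unit {n : ℕ} (P : Matrix (Fin n) (Fin n) ℝ) (hP0 : ∀ i j, 0 ≤ P i j)
    (hP1 : ∀ i, ∑ j, P i j = 1) {γ : ℝ} (hγ0 : 0 ≤ γ) (hγ1 : γ < 1) :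
    IsUnit ((1 : Matrix (Fin n) (Fin n) ℝ) - γ • P).det := by
  rw [isUnit_iff_ne_zero]
  apply det_ne_zero_of_sum_row_lt_diag
  intro k
  have h1 : ∑ j ∈ Finset.univ.erase k, ‖((1 : Matrix (Fin n) (Fin n) ℝ) - γ • P) k j‖
      = ∑ j ∈ Finset.univ.erase k, γ * P k j := by
    apply Finset.sum_congr rfl
    intro j hj
    have hjk : k ≠ j := (Finset.ne_of_mem_erase hj).symm
    simp [Matrix.one_apply_ne hjk, abs_of_nonneg hγ0, abs_of_nonneg (hP0 k j)]
  have h2 := Finset.add_sum_erase Finset.univ (P k) (Finset.mem_univ k)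
  rw [hP1 k] at h2
  rw [h1, ← Finset.mul_sum]
  refine lt_of_lt_of_le ?_ (le_abs_self _)
  simp only [Matrix.sub_apply, one_apply_eq, Matrix.smul_apply, smul_eq_mul]
  have h3 : ∑ j ∈ Finset.univ.erase k, P k j = 1 - P k k := by linarith
  rw [h3]; linarith

/-- approximation bound for the regularized TD fixed point via the
ridge-regularized projection: `‖Xw*_η − q‖ ≤ (1/ξ)‖Π^η_D q − q‖`. -/
theorem regularized_td_approximation_bound {n K : ℕ}
    (X : Matrix (Fin n) (Fin K) ℝ)
    (hX : LinearIndependent ℝ (fun j : Fin K => fun i : Fin n => X i j))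
    (d : Fin n → ℝ) (hd0 : ∀ i, 0 < d i) (hd1 : ∀ i, d i ≤ 1) (hdsum : ∑ i, d i = 1)
    (P : Matrix (Fin n) (Fin n) ℝ) (hP0 : ∀ i j, 0 ≤ P i j) (hP1 : ∀ i, ∑ j, P i j = 1)
    (r : Fin n → ℝ) {γ η ξ : ℝ} (hγ0 : 0 ≤ γ) (hγ1 : γ < 1) (hη : 0 < η)
    (hξ0 : 0 < ξ) (hξ1 : ξ < 1)
    (D : Matrix (Fin n) (Fin n) ℝ) (hD : D = Matrix.diagonal d)
    (normPD : ℝ)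
    (hPD : normPD = opNorm (Matrix.diagonal (fun i => Real.sqrt (d i)) * P *
      Matrix.diagonal fun i => (Real.sqrt (d i))⁻¹))
    (hcond : γ * opNorm X * normPD ≤ 2 * (1 - ξ) * Real.sqrt η)
    (q : Fin n → ℝ) (hq : q = ((1 : Matrix (Fin n) (Fin n) ℝ) - γ • P)⁻¹.mulVec r)
    (Pieta : Matrix (Fin n) (Fin n) ℝ)
    (hPieta : Pieta = X * (Xᵀ * D * X + η • (1 : Matrix (Fin K) (Fin K) ℝ))⁻¹ * Xᵀ * D)
    (w : Fin K → ℝ)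
    (hw : (Xᵀ * D * (1 - γ • P) * X + η • (1 : Matrix (Fin K) (Fin K) ℝ)).mulVec w =
      (Xᵀ * D).mulVec r) :
    evnorm (X.mulVec w - q) ≤ (1 / ξ) * evnorm (Pieta.mulVec q - q) := by
  have hS2 : Matrix.diagonal (fun i => Real.sqrt (d i)) * Matrix.diagonal (fun i => Real.sqrt (d i))
      = D := by
    rw [hD, diagonal_mul_diagonal]
    congr 1; funext i; exact Real.mul_self_sqrt (hd0 i).le
  have hSi : Matrix.diagonal (fun i => (Real.sqrt (d i))⁻¹) *
      Matrix.diagonal (fun i => Real.sqrt (d i)) = (1 : Matrix (Fin n) (Fin n) ℝ) := by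
    rw [diagonal_mul_diagonal, ← diagonal_one]
    congr 1; funext i; exact inv_mul_cancel₀ (Real.sqrt_pos.2 (hd0 i)).ne'
  have hSn : ∀ v : Fin n → ℝ, evnorm (Matrix.diagonal (fun i => Real.sqrt (d i)) *ᵥ v)
      ≤ evnorm v := by
    intro v
    refine le_of_abs_le (abs_le_of_sq_le_sq ?_ (evnorm_nonneg _))
    rw [evnorm_sq, evnorm_sq]
    apply Finset.sum_le_sum
    intro i _
    rw [mulVec_diagonal, mul_pow, Real.sq_sqrt (hd0 i).le]
    nlinarith [hd1 i, sq_nonneg (v i)]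
  set S := Matrix.diagonal (fun i => Real.sqrt (d i)) with hS
  set T := Matrix.diagonal (fun i => (Real.sqrt (d i))⁻¹) with hT
  have hSt : Sᵀ = S := diagonal_transpose _
  have hAA : (S * X)ᵀ * (S * X) = Xᵀ * D * X := by
    rw [transpose_mul, hSt, ← hS2]; simp only [Matrix.mul_assoc]
  set G := Xᵀ * D * X + η • (1 : Matrix (Fin K) (Fin K) ℝ) with hG
  have hGu : IsUnit G.det := by
    have hpd : G.PosDef := by
      rw [hG, ← hAA, ← conjTranspose_eq_transpose_of_trivial]
      exact PosDef.posSemidef_add (posSemidef_conjTranspose_mul_self _)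
        (PosDef.one.smul hη)
    exact hpd.det_pos.ne'.isUnit
  have hqe : q = r + γ • (P *ᵥ q) := by
    have h1 : (1 - γ • P) *ᵥ q = r := by
      rw [hq, mulVec_mulVec, mul_nonsing_inv _ (one_sub_unit P hP0 hP1 hγ0 hγ1), one_mulVec]
    rw [sub_mulVec, one_mulVec, smul_mulVec] at h1
    rw [← h1]; simp
  have hGw : G *ᵥ w = (Xᵀ * D) *ᵥ (r + γ • (P *ᵥ (X *ᵥ w))) := by
    rw [mulVec_add, ← hw, hG, Matrix.mul_sub, Matrix.sub_mul]
    simp only [add_mulVec, sub_mulVec, mulVec_smul, mulVec_mulVec, Matrix.mul_one, smul_mulVec,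
      Matrix.mul_smul, Matrix.smul_mul, Matrix.mul_assoc]
    abel
  set e := X *ᵥ w - q with he
  have hre : r + γ • (P *ᵥ (X *ᵥ w)) = q + γ • (P *ᵥ e) := by
    rw [he, mulVec_sub, smul_sub]
    have h0 : r = q - γ • (P *ᵥ q) := eq_sub_of_add_eq hqe.symm
    rw [h0]
    abel
  set z := G⁻¹ *ᵥ ((Xᵀ * D) *ᵥ (γ • (P *ᵥ e))) with hz
  have hXw : X *ᵥ w = Pieta *ᵥ q + X *ᵥ z := by
    have h1 : w = G⁻¹ *ᵥ ((Xᵀ * D) *ᵥ q) + z := by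
      rw [hz, ← mulVec_add, ← mulVec_add, ← hre, ← hGw, mulVec_mulVec, nonsing_inv_mul _ hGu,
        one_mulVec]
    nth_rewrite 1 [h1]
    rw [hPieta, mulVec_add]
    simp only [mulVec_mulVec, Matrix.mul_assoc]
  have hee : e = (Pieta *ᵥ q - q) + X *ᵥ z := by
    rw [he, hXw]; abel
  have hs : S *ᵥ (γ • (P *ᵥ e)) = γ • ((S * P * T) *ᵥ (S *ᵥ e)) := by
    rw [mulVec_smul, mulVec_mulVec, mulVec_mulVec, Matrix.mul_assoc (S * P), hSi, Matrix.mul_one]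
  have hzb : 2 * Real.sqrt η * evnorm z ≤ evnorm (S *ᵥ (γ • (P *ᵥ e))) := by
    apply ridge_bound (S * X) hη
    rw [hAA, ← hG, hz, mulVec_mulVec _ G, mul_nonsing_inv _ hGu, one_mulVec, transpose_mul, hSt,
      mulVec_mulVec _ (Xᵀ * S), Matrix.mul_assoc, hS2]
  have hsb : evnorm (S *ᵥ (γ • (P *ᵥ e))) ≤ γ * (normPD * evnorm e) := by
    rw [hs, evnorm_smul, abs_of_nonneg hγ0, hPD]
    apply mul_le_mul_of_nonneg_left _ hγ0
    exact (evnorm_mulVec _ _).trans (mul_le_mul_of_nonneg_left (hSn e) (opNorm_nonneg _))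
  have hXz : evnorm (X *ᵥ z) ≤ (1 - ξ) * evnorm e := by
    have hη' := Real.sqrt_pos.2 hη
    have h1 := evnorm_mulVec X z
    have h2 := mul_le_mul_of_nonneg_left (hzb.trans hsb) (opNorm_nonneg X)
    have h3 := mul_le_mul_of_nonneg_right hcond (evnorm_nonneg e)
    have h4 := mul_le_mul_of_nonneg_left h1 (by positivity : 0 ≤ 2 * Real.sqrt η)
    have h5 : 2 * Real.sqrt η * evnorm (X *ᵥ z) ≤ 2 * Real.sqrt η * ((1 - ξ) * evnorm e) := by
      linarith
    exact le_of_mul_le_mul_left h5 (by positivity)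
  have hfin := evnorm_add (Pieta *ᵥ q - q) (X *ᵥ z)
  rw [← hee] at hfin
  rw [one_div, inv_mul_eq_div, le_div_iff₀ hξ0]
  linarith
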